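/- arXiv:2205.08162 — 4 statements merged into one kernel-verified Lean document; each statement's English description precedes it below -/
import Mathlib

section
/- Fix s ∈ ℍ. On the open set of quaternions q with Q_{c,s}(q) ≠ 0 (i.e. q ∉ [s]), the Laplacian in the four real components of q of the left slice hyperholomorphic Cauchy kernel equals the left F-kernel: Δ_q S_L^{−1}(s,q) = −4(s−q̄)(s² − 2Re(q)s + |q|²)^{−2} = F_L(s,q); likewise Δ_q S_R^{−1}(s,q) = −4(s² − 2Re(q)s + |q|²)^{−2}(s−q̄) = F_R(s,q). -/
noncomputable section

open Quaternion Finset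

def e1 : Quaternion ℝ := ⟨0, 1, 0, 0⟩
def e2 : Quaternion ℝ := ⟨0, 0, 1, 0⟩
def e3 : Quaternion ℝ := ⟨0, 0, 0, 1⟩

/-- Left Fueter operator `Df = ∂₀f + e₁∂₁f + e₂∂₂f + e₃∂₃f` (real directional derivatives
along `1, e₁, e₂, e₃`). -/
def fueterL (f : Quaternion ℝ → Quaternion ℝ) (q : Quaternion ℝ) : Quaternion ℝ :=
  fderiv ℝ f q 1 + e1 * fderiv ℝ f q e1 + e2 * fderiv ℝ f q e2 + e3 * fderiv ℝ f q e3

/-- Right Fueter operator `fD = ∂₀f + (∂₁f)e₁ + (∂₂f)e₂ + (∂₃f)e₃`. -/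
def fueterR (f : Quaternion ℝ → Quaternion ℝ) (q : Quaternion ℝ) : Quaternion ℝ :=
  fderiv ℝ f q 1 + fderiv ℝ f q e1 * e1 + fderiv ℝ f q e2 * e2 + fderiv ℝ f q e3 * e3

/-- Second directional derivative along `v`. -/
def dir2 (f : Quaternion ℝ → Quaternion ℝ) (v q : Quaternion ℝ) : Quaternion ℝ :=
  fderiv ℝ (fun x => fderiv ℝ f x v) q v

/-- Laplacian in the four real coordinates of a quaternionic variable. -/
def quatLaplacian (f : Quaternion ℝ → Quaternion ℝ) (q : Quaternion ℝ) : Quaternion ℝ :=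
  dir2 f 1 q + dir2 f e1 q + dir2 f e2 q + dir2 f e3 q

/-- `Q_{c,s}(q) = s² − 2 Re(q) s + |q|²` (commutative pseudo Cauchy kernel denominator). -/
def Qcs (s q : Quaternion ℝ) : Quaternion ℝ :=
  s ^ 2 - 2 * (q.re : Quaternion ℝ) * s + ((‖q‖ ^ 2 : ℝ) : Quaternion ℝ)

/-- Left slice hyperholomorphic Cauchy kernel `S_L⁻¹(s,q) = (s − q̄) Q_{c,s}(q)⁻¹` (form II). -/
def SL (s q : Quaternion ℝ) : Quaternion ℝ := (s - star q) * (Qcs s q)⁻¹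

/-- Right slice hyperholomorphic Cauchy kernel `S_R⁻¹(s,q) = Q_{c,s}(q)⁻¹ (s − q̄)` (form II). -/
def SR (s q : Quaternion ℝ) : Quaternion ℝ := (Qcs s q)⁻¹ * (s - star q)

/-- Left F-kernel `F_L(s,q) = −4 (s − q̄) Q_{c,s}(q)⁻²`. -/
def FL (s q : Quaternion ℝ) : Quaternion ℝ := -4 * (s - star q) * ((Qcs s q) ^ 2)⁻¹

/-- Right F-kernel `F_R(s,q) = −4 Q_{c,s}(q)⁻² (s − q̄)`. -/
def FR (s q : Quaternion ℝ) : Quaternion ℝ := -4 * ((Qcs s q) ^ 2)⁻¹ * (s - star q)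

lemma norm_sq_eq_components (q : Quaternion ℝ) :
    ‖q‖ ^ 2 = q.re ^ 2 + q.imI ^ 2 + q.imJ ^ 2 + q.imK ^ 2 := by
  rw [pow_two, ← Quaternion.normSq_eq_norm_mul_self, Quaternion.normSq_def']

lemma e1_components : e1.re = 0 ∧ e1.imI = 1 ∧ e1.imJ = 0 ∧ e1.imK = 0 := ⟨rfl, rfl, rfl, rfl⟩

lemma e2_components : e2.re = 0 ∧ e2.imI = 0 ∧ e2.imJ = 1 ∧ e2.imK = 0 := ⟨rfl, rfl, rfl, rfl⟩

lemma e3_components : e3.re = 0 ∧ e3.imI = 0 ∧ e3.imJ = 0 ∧ e3.imK = 1 := ⟨rfl, rfl, rfl, rfl⟩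

lemma fderiv_quatInv {g : Quaternion ℝ → Quaternion ℝ} {q : Quaternion ℝ}
    (hg : DifferentiableAt ℝ g q) (h : g q ≠ 0) (v : Quaternion ℝ) :
    fderiv ℝ (fun x => (g x)⁻¹) q v = -((g q)⁻¹ * fderiv ℝ g q v * (g q)⁻¹) := by
  have := (hasFDerivAt_inv' (𝕜 := ℝ) h).comp q hg.hasFDerivAt
  have e := this.fderiv
  simp only [Function.comp_def] at e
  rw [e]; simp

lemma contDiffAt_quatInv {g : Quaternion ℝ → Quaternion ℝ} {q : Quaternion ℝ} {n : WithTop ℕ∞}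
    (hg : ContDiffAt ℝ n g q) (h : g q ≠ 0) : ContDiffAt ℝ n (fun x => (g x)⁻¹) q := by
  have := (contDiffAt_ringInverse ℝ (n := n) (Units.mk0 _ h)).comp q hg
  simpa [Function.comp_def, Ring.inverse_eq_inv] using this

lemma ContDiffAt.differentiableAt_fderiv_apply {f : Quaternion ℝ → Quaternion ℝ}
    {q : Quaternion ℝ} (hf : ContDiffAt ℝ 2 f q) (v : Quaternion ℝ) :
    DifferentiableAt ℝ (fun x => fderiv ℝ f x v) q :=
  ((hf.fderiv_right (m := 1) (by norm_num)).differentiableAt (by norm_num)).clm_apply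
    (differentiableAt_const v)

lemma ContDiffAt.eventually_differentiableAt {f : Quaternion ℝ → Quaternion ℝ}
    {q : Quaternion ℝ} (hf : ContDiffAt ℝ 2 f q) :
    ∀ᶠ x in nhds q, DifferentiableAt ℝ f x :=
  (hf.eventually (by simp)).mono fun _ hx => hx.differentiableAt (by norm_num)

lemma dir2_mul {f g : Quaternion ℝ → Quaternion ℝ} {q : Quaternion ℝ}
    (hf : ContDiffAt ℝ 2 f q) (hg : ContDiffAt ℝ 2 g q) (v : Quaternion ℝ) :
    dir2 (fun x => f x * g x) v q =
      dir2 f v q * g q + 2 * (fderiv ℝ f q v * fderiv ℝ g q v) + f q * dir2 g v q := by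
  have key : (fun x => fderiv ℝ (fun x => f x * g x) x v) =ᶠ[nhds q]
      fun x => f x * fderiv ℝ g x v + fderiv ℝ f x v * g x := by
    filter_upwards [hf.eventually_differentiableAt, hg.eventually_differentiableAt] with x h1 h2
    simp [fderiv_fun_mul' h1 h2]
  have hf1 := hf.differentiableAt (by norm_num)
  have hg1 := hg.differentiableAt (by norm_num)
  have hf2 := hf.differentiableAt_fderiv_apply v
  have hg2 := hg.differentiableAt_fderiv_apply v
  rw [dir2, key.fderiv_eq, fderiv_fun_add (hf1.fun_mul hg2) (hf2.fun_mul hg1), fderiv_fun_mul' hf1 hg2,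
    fderiv_fun_mul' hf2 hg1]
  simp [dir2]
  noncomm_ring

lemma dir2_inv {g : Quaternion ℝ → Quaternion ℝ} {q : Quaternion ℝ}
    (hg : ContDiffAt ℝ 2 g q) (h : g q ≠ 0) (v : Quaternion ℝ) :
    dir2 (fun x => (g x)⁻¹) v q =
      2 * ((g q)⁻¹ * fderiv ℝ g q v * (g q)⁻¹ * fderiv ℝ g q v * (g q)⁻¹) -
        (g q)⁻¹ * dir2 g v q * (g q)⁻¹ := by
  have key : (fun x => fderiv ℝ (fun x => (g x)⁻¹) x v) =ᶠ[nhds q]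
      fun x => -((g x)⁻¹ * fderiv ℝ g x v * (g x)⁻¹) := by
    filter_upwards [hg.eventually_differentiableAt,
      hg.continuousAt.eventually_ne h] with x h1 h2
    exact fderiv_quatInv h1 h2 v
  have hg1 := hg.differentiableAt (by norm_num)
  have hi := (contDiffAt_quatInv hg h).differentiableAt (by norm_num)
  have hg2 := hg.differentiableAt_fderiv_apply v
  rw [dir2, key.fderiv_eq, fderiv_fun_neg, fderiv_fun_mul' (hi.fun_mul hg2) hi,
    fderiv_fun_mul' hi hg2]
  simp [dir2, fderiv_quatInv hg1 h]
  noncomm_ring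

lemma sub_star_eq_smul (s x : Quaternion ℝ) :
    s - star x = s - ((2 * inner ℝ 1 x) • (1 : Quaternion ℝ) - x) := by
  ext <;> simp [Quaternion.inner_def, two_mul]

lemma fderiv_sub_star (s q v : Quaternion ℝ) :
    fderiv ℝ (fun x : Quaternion ℝ => s - star x) q v = -star v := by
  have h : HasFDerivAt (fun x : Quaternion ℝ => (2 * inner ℝ 1 x) • (1 : Quaternion ℝ)) _ q :=
    (((hasFDerivAt_const (1 : Quaternion ℝ) q).inner ℝ (hasFDerivAt_id q)).const_mul 2).smul_const 1
  have hx : HasFDerivAt (fun x : Quaternion ℝ => x) (ContinuousLinearMap.id ℝ _) q := hasFDerivAt_id q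
  rw [funext (sub_star_eq_smul s), ((h.fun_sub hx).const_sub s).fderiv]
  ext <;> simp [Quaternion.inner_def, two_mul]

lemma dir2_sub_star (s v q : Quaternion ℝ) :
    dir2 (fun x : Quaternion ℝ => s - star x) v q = 0 := by
  simp [dir2, fderiv_sub_star]

lemma contDiff_sub_star (s : Quaternion ℝ) {n : WithTop ℕ∞} :
    ContDiff ℝ n (fun x : Quaternion ℝ => s - star x) := by
  simp only [sub_star_eq_smul]
  exact contDiff_const.sub (((contDiff_const.mul (contDiff_const.inner ℝ contDiff_id)).smul
    contDiff_const).sub contDiff_id)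

lemma Qcs_eq_smul (s x : Quaternion ℝ) :
    Qcs s x = s ^ 2 - (2 * inner ℝ 1 x) • s + (inner ℝ x x) • (1 : Quaternion ℝ) := by
  rw [Qcs, real_inner_self_eq_norm_sq, Quaternion.inner_def,
    show (2 : Quaternion ℝ) = ((2 : ℝ) : Quaternion ℝ) by norm_cast]
  ext <;> simp [mul_assoc, -Quaternion.coe_pow]

lemma contDiff_Qcs (s : Quaternion ℝ) {n : WithTop ℕ∞} : ContDiff ℝ n (Qcs s) := by
  rw [funext (Qcs_eq_smul s)]
  exact (contDiff_const.sub ((contDiff_const.mul (contDiff_const.inner ℝ contDiff_id)).smul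
    contDiff_const)).add ((contDiff_id.inner ℝ contDiff_id).smul contDiff_const)

lemma fderiv_Qcs (s q v : Quaternion ℝ) :
    fderiv ℝ (Qcs s) q v =
      ((2 * inner ℝ q v : ℝ) : Quaternion ℝ) - ((2 * v.re : ℝ) : Quaternion ℝ) * s := by
  have h1 : HasFDerivAt (fun x : Quaternion ℝ => (2 * inner ℝ 1 x) • s) _ q :=
    (((hasFDerivAt_const (1 : Quaternion ℝ) q).inner ℝ (hasFDerivAt_id q)).const_mul 2).smul_const s
  have h2 : HasFDerivAt (fun x : Quaternion ℝ => inner ℝ x x • (1 : Quaternion ℝ)) _ q :=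
    ((hasFDerivAt_id q).inner ℝ (hasFDerivAt_id q)).smul_const 1
  rw [funext (Qcs_eq_smul s), ((h1.const_sub (s ^ 2)).fun_add h2).fderiv]
  ext <;> simp [real_inner_comm, Quaternion.inner_def]
  ring

lemma dir2_Qcs (s v q : Quaternion ℝ) :
    dir2 (Qcs s) v q = ((2 * ‖v‖ ^ 2 : ℝ) : Quaternion ℝ) := by
  have h : HasFDerivAt (fun x : Quaternion ℝ => (2 * inner ℝ x v) • (1 : Quaternion ℝ)) _ q :=
    (((hasFDerivAt_id q).inner ℝ (hasFDerivAt_const v q)).const_mul 2).smul_const 1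
  have e : (fun x => fderiv ℝ (Qcs s) x v) = fun x => (2 * inner ℝ x v) • (1 : Quaternion ℝ) -
      ((2 * v.re : ℝ) : Quaternion ℝ) * s := by
    funext x
    rw [fderiv_Qcs, Algebra.smul_def, mul_one]
    rfl
  rw [dir2, e, (h.sub_const _).fderiv]
  ext <;> simp [-Quaternion.coe_pow]

lemma Qcs_commute (s q : Quaternion ℝ) : Commute (Qcs s q) s := by
  rw [Qcs_eq_smul]
  exact (((Commute.refl s).pow_left 2).sub_left ((Commute.refl s).smul_left _)).add_left
    ((Commute.one_left s).smul_left _)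

lemma commute_inv_fderiv_Qcs (s q v : Quaternion ℝ) :
    Commute (Qcs s q)⁻¹ (fderiv ℝ (Qcs s) q v) := by
  rw [fderiv_Qcs]
  have hr (r : ℝ) : Commute (Qcs s q)⁻¹ (r : Quaternion ℝ) := (Quaternion.coe_commutes _ _).symm
  exact (hr _).sub_right ((hr _).mul_right (Qcs_commute s q).inv_left₀)

/-- The first derivatives of `Qcs s` satisfy `∑ (∂ᵥ Q)² = 4 Q`. -/
lemma sum_sq_fderiv_Qcs (s q : Quaternion ℝ) :
    fderiv ℝ (Qcs s) q 1 ^ 2 + fderiv ℝ (Qcs s) q e1 ^ 2 + fderiv ℝ (Qcs s) q e2 ^ 2 +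
      fderiv ℝ (Qcs s) q e3 ^ 2 = 4 * Qcs s q := by
  rw [Qcs_eq_smul, show (4 : Quaternion ℝ) = ((4 : ℝ) : Quaternion ℝ) by norm_cast]
  simp only [fderiv_Qcs, pow_two]
  ext <;> simp [Quaternion.inner_def, norm_sq_eq_components, e1_components, e2_components,
    e3_components] <;> ring

lemma sum_star_mul_fderiv_Qcs (s q : Quaternion ℝ) :
    star 1 * fderiv ℝ (Qcs s) q 1 + star e1 * fderiv ℝ (Qcs s) q e1 +
      star e2 * fderiv ℝ (Qcs s) q e2 + star e3 * fderiv ℝ (Qcs s) q e3 =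
        -2 * (s - star q) := by
  rw [show (-2 : Quaternion ℝ) = ((-2 : ℝ) : Quaternion ℝ) by norm_cast]
  simp only [fderiv_Qcs]
  ext <;> simp [Quaternion.inner_def, e1_components, e2_components, e3_components] <;> ring

lemma sum_fderiv_Qcs_mul_star (s q : Quaternion ℝ) :
    fderiv ℝ (Qcs s) q 1 * star 1 + fderiv ℝ (Qcs s) q e1 * star e1 +
      fderiv ℝ (Qcs s) q e2 * star e2 + fderiv ℝ (Qcs s) q e3 * star e3 =
        -2 * (s - star q) := by
  rw [show (-2 : Quaternion ℝ) = ((-2 : ℝ) : Quaternion ℝ) by norm_cast]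
  simp only [fderiv_Qcs]
  ext <;> simp [Quaternion.inner_def, e1_components, e2_components, e3_components] <;> ring

lemma fderiv_inv_Qcs {s q : Quaternion ℝ} (h : Qcs s q ≠ 0) (v : Quaternion ℝ) :
    fderiv ℝ (fun x => (Qcs s x)⁻¹) q v = -(fderiv ℝ (Qcs s) q v * ((Qcs s q) ^ 2)⁻¹) := by
  rw [fderiv_quatInv ((contDiff_Qcs s (n := 1)).differentiable (by norm_num) q) h,
    (commute_inv_fderiv_Qcs s q v).eq, mul_assoc, ← inv_pow, pow_two]

lemma dir2_inv_Qcs {s q : Quaternion ℝ} (h : Qcs s q ≠ 0) (v : Quaternion ℝ) :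
    dir2 (fun x => (Qcs s x)⁻¹) v q =
      2 * (fderiv ℝ (Qcs s) q v ^ 2 * (Qcs s q)⁻¹ ^ 3) -
        ((2 * ‖v‖ ^ 2 : ℝ) : Quaternion ℝ) * (Qcs s q)⁻¹ ^ 2 := by
  have hc := commute_inv_fderiv_Qcs s q v
  rw [dir2_inv (contDiff_Qcs s).contDiffAt h, dir2_Qcs, ← Quaternion.coe_commutes, hc.eq]
  congr 1
  · rw [mul_assoc _ (Qcs s q)⁻¹ (fderiv ℝ (Qcs s) q v), hc.eq]
    simp only [pow_succ, pow_zero, one_mul, mul_assoc]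
    rw [← mul_assoc (Qcs s q)⁻¹ (fderiv ℝ (Qcs s) q v), hc.eq, mul_assoc]
  · rw [pow_two (Qcs s q)⁻¹, mul_assoc]

/-- The pseudo Cauchy kernel `Q⁻¹` is harmonic. -/
lemma quatLaplacian_inv_Qcs {s q : Quaternion ℝ} (h : Qcs s q ≠ 0) :
    quatLaplacian (fun x => (Qcs s x)⁻¹) q = 0 := by
  have n1 : ‖e1‖ ^ 2 = 1 := by
    simp only [norm_sq_eq_components, e1_components]; norm_num
  have n2 : ‖e2‖ ^ 2 = 1 := by
    simp only [norm_sq_eq_components, e2_components]; norm_num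
  have n3 : ‖e3‖ ^ 2 = 1 := by
    simp only [norm_sq_eq_components, e3_components]; norm_num
  have hs := congrArg (fun x => 2 * (x * (Qcs s q)⁻¹ ^ 3)) (sum_sq_fderiv_Qcs s q)
  have hQ : 4 * Qcs s q * (Qcs s q)⁻¹ ^ 3 = 4 * (Qcs s q)⁻¹ ^ 2 := by
    rw [pow_succ' _ 2, mul_assoc, mul_inv_cancel_left₀ h]
  simp only [hQ, add_mul, mul_add] at hs
  have h2 : ((2 : ℝ) : Quaternion ℝ) = 2 := by norm_cast
  simp only [quatLaplacian, dir2_inv_Qcs h, n1, n2, n3, norm_one, one_pow, mul_one, h2]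
  rw [show ∀ a b c d e : Quaternion ℝ, a - e + (b - e) + (c - e) + (d - e) =
    a + b + c + d - (e + e + e + e) from fun _ _ _ _ _ => by abel, hs]
  noncomm_ring

lemma quatLaplacian_mul {f g : Quaternion ℝ → Quaternion ℝ} {q : Quaternion ℝ}
    (hf : ContDiffAt ℝ 2 f q) (hg : ContDiffAt ℝ 2 g q) :
    quatLaplacian (fun x => f x * g x) q =
      quatLaplacian f q * g q + 2 * (fderiv ℝ f q 1 * fderiv ℝ g q 1 +
        fderiv ℝ f q e1 * fderiv ℝ g q e1 + fderiv ℝ f q e2 * fderiv ℝ g q e2 +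
        fderiv ℝ f q e3 * fderiv ℝ g q e3) + f q * quatLaplacian g q := by
  simp only [quatLaplacian, dir2_mul hf hg, mul_add, add_mul]
  abel

lemma quatLaplacian_sub_star (s q : Quaternion ℝ) :
    quatLaplacian (fun x : Quaternion ℝ => s - star x) q = 0 := by
  simp [quatLaplacian, dir2_sub_star]

lemma quatLaplacian_SL {s q : Quaternion ℝ} (h : Qcs s q ≠ 0) :
    quatLaplacian (fun x => SL s x) q = FL s q := by
  simp only [SL, FL]
  rw [quatLaplacian_mul (contDiff_sub_star s).contDiffAt
    (contDiffAt_quatInv (contDiff_Qcs s).contDiffAt h), quatLaplacian_inv_Qcs h,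
    quatLaplacian_sub_star]
  simp only [fderiv_sub_star, fderiv_inv_Qcs h, neg_mul_neg, ← mul_assoc, ← add_mul,
    sum_star_mul_fderiv_Qcs]
  noncomm_ring

lemma quatLaplacian_SR {s q : Quaternion ℝ} (h : Qcs s q ≠ 0) :
    quatLaplacian (fun x => SR s x) q = FR s q := by
  have hc (v : Quaternion ℝ) : fderiv ℝ (Qcs s) q v * ((Qcs s q) ^ 2)⁻¹ =
      ((Qcs s q) ^ 2)⁻¹ * fderiv ℝ (Qcs s) q v := by
    rw [← inv_pow]
    exact ((commute_inv_fderiv_Qcs s q v).pow_left 2).symm.eq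
  simp only [SR, FR]
  rw [quatLaplacian_mul (contDiffAt_quatInv (contDiff_Qcs s).contDiffAt h)
    (contDiff_sub_star s).contDiffAt, quatLaplacian_inv_Qcs h, quatLaplacian_sub_star]
  simp only [fderiv_sub_star, fderiv_inv_Qcs h, neg_mul_neg, hc, mul_assoc, ← mul_add,
    sum_fderiv_Qcs_mul_star]
  noncomm_ring

/-- The Laplacian (in the four real components of `q`) of the slice hyperholomorphic Cauchy
kernels equals the corresponding F-kernels:
`Δ_q S_L⁻¹(s,q) = −4(s−q̄)(s²−2Re(q)s+|q|²)⁻² = F_L(s,q)` and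
`Δ_q S_R⁻¹(s,q) = −4(s²−2Re(q)s+|q|²)⁻²(s−q̄) = F_R(s,q)`. -/
theorem laplacian_cauchyKernel_eq_Fkernel (s q : Quaternion ℝ) (h : Qcs s q ≠ 0) :
    quatLaplacian (fun x => SL s x) q
        = -4 * (s - star q) *
          (((s ^ 2 - 2 * (q.re : Quaternion ℝ) * s + ((‖q‖ ^ 2 : ℝ) : Quaternion ℝ)) ^ 2)⁻¹) ∧
    quatLaplacian (fun x => SL s x) q = FL s q ∧
    quatLaplacian (fun x => SR s x) q
        = -4 * (((s ^ 2 - 2 * (q.re : Quaternion ℝ) * s + ((‖q‖ ^ 2 : ℝ) : Quaternion ℝ)) ^ 2)⁻¹) *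
          (s - star q) ∧
    quatLaplacian (fun x => SR s x) q = FR s q := by
  exact ⟨quatLaplacian_SL h, quatLaplacian_SL h, quatLaplacian_SR h, quatLaplacian_SR h⟩
end
end

section
/- For every integer n ≥ 1 and every q ∈ ℍ, the Fueter operator applied to the power function x ↦ xⁿ at q has the closed form: D(xⁿ)(q) = −2n·q^{n−1} if Im(q) = 0, and D(xⁿ)(q) = −(Im(q))^{−1}·(qⁿ − q̄ⁿ) if Im(q) ≠ 0. -/
noncomputable section

open Quaternion Finset

/-- Sandwiching by the quaternionic units: `a + e₁ a e₁ + e₂ a e₂ + e₃ a e₃ = −2 ā`. -/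
theorem add_units_sandwich_eq (a : Quaternion ℝ) :
    a + e1 * (a * e1) + e2 * (a * e2) + e3 * (a * e3) = -2 * star a := by
  have h2 : (-2 : Quaternion ℝ) = ((-2 : ℝ) : Quaternion ℝ) := by norm_cast
  rw [h2, Quaternion.coe_mul_eq_smul]
  ext <;> simp <;> simp [e1, e2, e3] <;> ring

theorem commute_star_self (q : Quaternion ℝ) : Commute q (star q) :=
  (star_comm_self' q).symm

/-- The derivative of the power function on `ℍ` in the direction `v`. -/
theorem fderiv_quaternion_pow_apply (n : ℕ) (q v : Quaternion ℝ) :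
    fderiv ℝ (fun x : Quaternion ℝ => x ^ n) q v =
      ∑ i ∈ range n, q ^ (n - 1 - i) * v * q ^ i := by
  rw [fderiv_pow_ring']
  simp [mul_assoc]

theorem fueterL_pow (n : ℕ) (q : Quaternion ℝ) :
    fueterL (fun x => x ^ n) q =
      -2 * ∑ i ∈ range n, q ^ i * star q ^ (n - 1 - i) := by
  simp only [fueterL, fderiv_quaternion_pow_apply, mul_sum, ← sum_add_distrib]
  refine sum_congr rfl fun i _ => ?_
  rw [((commute_star_self q).pow_pow i (n - 1 - i)).eq, ← star_pow,
    ← mul_assoc (-2), ← add_units_sandwich_eq]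
  simp only [add_mul, mul_one, mul_assoc]

/-- Closed form for the Fueter derivative of the power function: for `n ≥ 1`,
`D(xⁿ)(q) = −2n q^{n−1}` if `Im q = 0`, and `D(xⁿ)(q) = −(Im q)⁻¹ (qⁿ − q̄ⁿ)` if `Im q ≠ 0`. -/
theorem fueter_pow_closed_form (n : ℕ) (hn : 1 ≤ n) (q : Quaternion ℝ) :
    (q.im = 0 → fueterL (fun x => x ^ n) q = -2 * (n : Quaternion ℝ) * q ^ (n - 1)) ∧
    (q.im ≠ 0 → fueterL (fun x => x ^ n) q = -(q.im)⁻¹ * (q ^ n - (star q) ^ n)) := by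
  have hsub : q - star q = 2 * q.im := by
    rw [two_mul]
    ext <;> simp
  rw [fueterL_pow]
  refine ⟨fun h => ?_, fun h => ?_⟩
  · have hq : star q = q := by
      rw [h, mul_zero, sub_eq_zero] at hsub
      exact hsub.symm
    have hsum : ∑ i ∈ range n, q ^ i * q ^ (n - 1 - i) = n * q ^ (n - 1) := by
      rw [sum_congr rfl fun i hi => by
        rw [← pow_add, Nat.add_sub_cancel' (Nat.le_sub_one_of_lt (mem_range.mp hi))]]
      simp
    rw [hq, hsum, mul_assoc]
  · rw [← (commute_star_self q).mul_geom_sum₂, hsub, neg_mul, neg_mul, ← mul_assoc,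
      (Commute.ofNat_left 2 q.im).eq, ← mul_assoc, inv_mul_cancel₀ h, one_mul]
end
end

section
/- Let Ω ⊆ ℍ be a nonempty connected axially symmetric open set that intersects the real line, and let f : Ω → ℍ be left slice hyperholomorphic. If Df = 0 on Ω (i.e. f lies in the kernel of the Fueter operator), then f is constant: there exists α ∈ ℍ with f(q) = α for all q ∈ Ω. -/
noncomputable section

open Quaternion Finset

/-- `(u,v)` lies over the axially symmetric set `U`: the whole sphere `u + 𝕊v` is in `U`. -/
def inSlice (U : Set (Quaternion ℝ)) (u v : ℝ) : Prop :=
  ∀ J : Quaternion ℝ, J.re = 0 → ‖J‖ = 1 → (u : Quaternion ℝ) + v • J ∈ U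

/-- `f` is left slice hyperholomorphic on `U` with components `α, β`: the even/odd conditions,
differentiability and the Cauchy–Riemann system hold on
`𝒰 = {(u,v) : u + 𝕊v ⊆ U}`, and `f(u + Jv) = α(u,v) + Jβ(u,v)`. -/
def IsSliceHypL (U : Set (Quaternion ℝ)) (f : Quaternion ℝ → Quaternion ℝ)
    (α β : ℝ → ℝ → Quaternion ℝ) : Prop :=
  (∀ u v : ℝ, inSlice U u v → α u (-v) = α u v ∧ β u (-v) = -β u v) ∧
  (∀ u v : ℝ, inSlice U u v →
    DifferentiableAt ℝ (fun p : ℝ × ℝ => α p.1 p.2) (u, v) ∧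
    DifferentiableAt ℝ (fun p : ℝ × ℝ => β p.1 p.2) (u, v) ∧
    deriv (fun t => α t v) u - deriv (fun t => β u t) v = 0 ∧
    deriv (fun t => α u t) v + deriv (fun t => β t v) u = 0) ∧
  (∀ (u v : ℝ) (J : Quaternion ℝ), J.re = 0 → ‖J‖ = 1 →
    (u : Quaternion ℝ) + v • J ∈ U → f ((u : Quaternion ℝ) + v • J) = α u v + J * β u v)

@[simp] theorem e1_re : e1.re = 0 := rfl
@[simp] theorem e1_imI : e1.imI = 1 := rfl
@[simp] theorem e1_imJ : e1.imJ = 0 := rfl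
@[simp] theorem e1_imK : e1.imK = 0 := rfl

@[simp] theorem e2_re : e2.re = 0 := rfl
@[simp] theorem e2_imI : e2.imI = 0 := rfl
@[simp] theorem e2_imJ : e2.imJ = 1 := rfl
@[simp] theorem e2_imK : e2.imK = 0 := rfl

@[simp] theorem e3_re : e3.re = 0 := rfl
@[simp] theorem e3_imI : e3.imI = 0 := rfl
@[simp] theorem e3_imJ : e3.imJ = 0 := rfl
@[simp] theorem e3_imK : e3.imK = 1 := rfl

theorem norm_quaternion_e1 : ‖e1‖ = 1 := by
  have h : ‖e1‖ * ‖e1‖ = 1 := by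
    rw [← Quaternion.normSq_eq_norm_mul_self, Quaternion.normSq_def']
    simp
  nlinarith [norm_nonneg e1]

/-- A set is axially symmetric if it contains the whole sphere `u + v𝕊` as soon as it contains
one of its points. -/
def IsAxiallySymmetric (U : Set (Quaternion ℝ)) : Prop :=
  ∀ (u v : ℝ) (J : Quaternion ℝ), J.re = 0 → ‖J‖ = 1 → (u : Quaternion ℝ) + v • J ∈ U →
    ∀ J' : Quaternion ℝ, J'.re = 0 → ‖J'‖ = 1 → (u : Quaternion ℝ) + v • J' ∈ U

theorem exists_imaginary_unit (q : Quaternion ℝ) :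
    ∃ J : Quaternion ℝ, J.re = 0 ∧ ‖J‖ = 1 ∧ q = (q.re : Quaternion ℝ) + ‖q.im‖ • J := by
  by_cases h : q.im = 0
  · refine ⟨e1, rfl, norm_quaternion_e1, ?_⟩
    rw [h, norm_zero, zero_smul, add_zero]
    conv_lhs => rw [← Quaternion.re_add_im q, h, add_zero]
  · have h0 : ‖q.im‖ ≠ 0 := norm_ne_zero_iff.mpr h
    refine ⟨‖q.im‖⁻¹ • q.im, by simp, ?_, ?_⟩
    · rw [norm_smul, norm_inv, norm_norm, inv_mul_cancel₀ h0]
    · rw [smul_inv_smul₀ h0, Quaternion.re_add_im]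

theorem IsAxiallySymmetric.inSlice_of_mem {U : Set (Quaternion ℝ)} (hax : IsAxiallySymmetric U)
    {u v : ℝ} {J : Quaternion ℝ} (hJ : J.re = 0) (hJ' : ‖J‖ = 1)
    (h : (u : Quaternion ℝ) + v • J ∈ U) : inSlice U u v :=
  hax u v J hJ hJ' h

theorem IsAxiallySymmetric.inSlice_re_norm_im {U : Set (Quaternion ℝ)}
    (hax : IsAxiallySymmetric U) {q : Quaternion ℝ} (hq : q ∈ U) : inSlice U q.re ‖q.im‖ := by
  obtain ⟨J, hJ, hJ', h⟩ := exists_imaginary_unit q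
  rw [h] at hq
  exact hax.inSlice_of_mem hJ hJ' hq

theorem IsAxiallySymmetric.isOpen_inSlice {U : Set (Quaternion ℝ)} (hax : IsAxiallySymmetric U)
    (hopen : IsOpen U) : IsOpen {p : ℝ × ℝ | inSlice U p.1 p.2} := by
  have h : {p : ℝ × ℝ | inSlice U p.1 p.2} =
      (fun p : ℝ × ℝ => (p.1 : Quaternion ℝ) + p.2 • e1) ⁻¹' U := by
    ext p
    exact ⟨fun h => h e1 rfl norm_quaternion_e1, fun h => hax.inSlice_of_mem rfl norm_quaternion_e1 h⟩
  rw [h]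
  refine hopen.preimage ?_
  have := Quaternion.continuous_coe
  fun_prop

theorem continuous_re_norm_im :
    Continuous (fun q : Quaternion ℝ => (q.re, ‖q.im‖)) :=
  Quaternion.continuous_re.prodMk Quaternion.continuous_im.norm

theorem hasDerivAt_quaternion_coe (t : ℝ) :
    HasDerivAt (fun s : ℝ => (s : Quaternion ℝ)) 1 t := by
  have h := (hasDerivAt_id t).smul_const (1 : Quaternion ℝ)
  simp only [id, one_smul] at h
  refine h.congr_of_eventuallyEq (Filter.Eventually.of_forall fun s => ?_)
  simp [Algebra.smul_def]

/-- Off the real axis, `α(Re q, |Im q|) + (Im q / |Im q|) β(Re q, |Im q|)` is differentiable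
wherever `α` and `β` are. -/
theorem IsSliceHypL.differentiableAt {U : Set (Quaternion ℝ)} {f : Quaternion ℝ → Quaternion ℝ}
    {α β : ℝ → ℝ → Quaternion ℝ} (hf : IsSliceHypL U f α β) (hopen : IsOpen U)
    (hax : IsAxiallySymmetric U) {q : Quaternion ℝ} (hq : q ∈ U) (him : q.im ≠ 0) :
    DifferentiableAt ℝ f q := by
  obtain ⟨hα, hβ, -, -⟩ := hf.2.1 q.re ‖q.im‖ (hax.inSlice_re_norm_im hq)
  let reL : Quaternion ℝ →L[ℝ] ℝ :=
    ⟨{ toFun := fun x => x.re, map_add' := fun _ _ => rfl, map_smul' := fun _ _ => rfl },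
      Quaternion.continuous_re⟩
  let imL : Quaternion ℝ →L[ℝ] Quaternion ℝ :=
    ⟨{ toFun := fun x => x.im, map_add' := fun x y => by simp, map_smul' := fun c x => by simp },
      Quaternion.continuous_im⟩
  have hre : DifferentiableAt ℝ (fun x : Quaternion ℝ => x.re) q := reL.differentiableAt
  have hi : DifferentiableAt ℝ (fun x : Quaternion ℝ => x.im) q := imL.differentiableAt
  have hn : DifferentiableAt ℝ (fun x : Quaternion ℝ => ‖x.im‖) q := hi.norm ℝ him
  have hp : DifferentiableAt ℝ (fun x : Quaternion ℝ => (x.re, ‖x.im‖)) q := hre.prodMk hn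
  have hα' : DifferentiableAt ℝ (fun x : Quaternion ℝ => α x.re ‖x.im‖) q :=
    DifferentiableAt.comp (g := fun p : ℝ × ℝ => α p.1 p.2) q hα hp
  have hβ' : DifferentiableAt ℝ (fun x : Quaternion ℝ => β x.re ‖x.im‖) q :=
    DifferentiableAt.comp (g := fun p : ℝ × ℝ => β p.1 p.2) q hβ hp
  have hJ : DifferentiableAt ℝ (fun x : Quaternion ℝ => ‖x.im‖⁻¹ • x.im) q :=
    (hn.inv (norm_ne_zero_iff.mpr him)).smul hi
  refine (hα'.add (hJ.mul hβ')).congr_of_eventuallyEq ?_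
  filter_upwards [hopen.mem_nhds hq,
    Quaternion.continuous_im.continuousAt.eventually_ne him] with x hx hxim
  have h0 : ‖x.im‖ ≠ 0 := norm_ne_zero_iff.mpr hxim
  have hx' : (x.re : Quaternion ℝ) + ‖x.im‖ • (‖x.im‖⁻¹ • x.im) = x := by
    rw [smul_inv_smul₀ h0, Quaternion.re_add_im]
  have key := hf.2.2 x.re ‖x.im‖ (‖x.im‖⁻¹ • x.im) (by simp)
    (by rw [norm_smul, norm_inv, norm_norm, inv_mul_cancel₀ h0]) (by rwa [hx'])
  rwa [hx'] at key

/-- Derivative of a slice function along the sphere `u + v𝕊`. -/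
theorem IsSliceHypL.smul_fderiv_of_orthogonal {U : Set (Quaternion ℝ)}
    {f : Quaternion ℝ → Quaternion ℝ} {α β : ℝ → ℝ → Quaternion ℝ} (hf : IsSliceHypL U f α β)
    {u v : ℝ} (hs : inSlice U u v) {J K : Quaternion ℝ}
    (hd : DifferentiableAt ℝ f ((u : Quaternion ℝ) + v • J))
    (hJ : J.re = 0) (hK : K.re = 0)
    (hnorm : ∀ t : ℝ, ‖Real.cos t • J + Real.sin t • K‖ = 1) :
    v • fderiv ℝ f ((u : Quaternion ℝ) + v • J) K = K * β u v := by
  have hc : HasDerivAt (fun t : ℝ => Real.cos t • J + Real.sin t • K) K 0 := by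
    simpa using ((Real.hasDerivAt_cos 0).smul_const J).fun_add ((Real.hasDerivAt_sin 0).smul_const K)
  have hγ : HasDerivAt
      (fun t : ℝ => (u : Quaternion ℝ) + v • (Real.cos t • J + Real.sin t • K)) (v • K) 0 :=
    (hc.const_smul v).const_add _
  have h0 : (u : Quaternion ℝ) + v • (Real.cos 0 • J + Real.sin 0 • K) = u + v • J := by simp
  have h1 := HasFDerivAt.comp_hasDerivAt (0 : ℝ) (by rw [h0]; exact hd.hasFDerivAt) hγ
  have h2 : HasDerivAt (fun t : ℝ => α u v + (Real.cos t • J + Real.sin t • K) * β u v)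
      (K * β u v) 0 := (hc.mul_const (β u v)).const_add _
  have h3 := h1.unique (h2.congr_of_eventuallyEq (Filter.Eventually.of_forall fun t =>
    hf.2.2 u v _ (by simp [hJ, hK]) (hnorm t) (hs _ (by simp [hJ, hK]) (hnorm t))))
  rwa [map_smul] at h3

/-- On the slice through `e₁`, the Fueter operator acts as `-2 β / v`. -/
theorem IsSliceHypL.smul_fueterL {U : Set (Quaternion ℝ)} {f : Quaternion ℝ → Quaternion ℝ}
    {α β : ℝ → ℝ → Quaternion ℝ} (hf : IsSliceHypL U f α β) (hopen : IsOpen U)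
    (hax : IsAxiallySymmetric U) {u v : ℝ} (hs : inSlice U u v) (hv : v ≠ 0) :
    v • fueterL f ((u : Quaternion ℝ) + v • e1) = (-2 : ℝ) • β u v := by
  have hq := hs e1 rfl norm_quaternion_e1
  have him : ((u : Quaternion ℝ) + v • e1).im ≠ 0 := by
    intro h
    have := congrArg (fun x : Quaternion ℝ => x.imI) h
    exact hv (by simpa using this)
  have hd := hf.differentiableAt hopen hax hq him
  have hnorm2 (t : ℝ) : ‖Real.cos t • e1 + Real.sin t • e2‖ = 1 := by
    have h : ‖Real.cos t • e1 + Real.sin t • e2‖ * ‖Real.cos t • e1 + Real.sin t • e2‖ = 1 := by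
      rw [← Quaternion.normSq_eq_norm_mul_self, Quaternion.normSq_def']
      simp
    nlinarith [norm_nonneg (Real.cos t • e1 + Real.sin t • e2)]
  have hnorm3 (t : ℝ) : ‖Real.cos t • e1 + Real.sin t • e3‖ = 1 := by
    have h : ‖Real.cos t • e1 + Real.sin t • e3‖ * ‖Real.cos t • e1 + Real.sin t • e3‖ = 1 := by
      rw [← Quaternion.normSq_eq_norm_mul_self, Quaternion.normSq_def']
      simp
    nlinarith [norm_nonneg (Real.cos t • e1 + Real.sin t • e3)]
  have hf2 := hf.smul_fderiv_of_orthogonal hs hd rfl rfl hnorm2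
  have hf3 := hf.smul_fderiv_of_orthogonal hs hd rfl rfl hnorm3
  obtain ⟨hα, hβ, hcr1, hcr2⟩ := hf.2.1 u v hs
  have hαu : DifferentiableAt ℝ (fun t => α t v) u :=
    DifferentiableAt.comp (g := fun p : ℝ × ℝ => α p.1 p.2) (f := fun t : ℝ => (t, v)) u hα
      (by fun_prop)
  have hβu : DifferentiableAt ℝ (fun t => β t v) u :=
    DifferentiableAt.comp (g := fun p : ℝ × ℝ => β p.1 p.2) (f := fun t : ℝ => (t, v)) u hβ
      (by fun_prop)
  have hαv : DifferentiableAt ℝ (fun t => α u t) v :=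
    DifferentiableAt.comp (g := fun p : ℝ × ℝ => α p.1 p.2) (f := fun t : ℝ => (u, t)) v hα
      (by fun_prop)
  have hβv : DifferentiableAt ℝ (fun t => β u t) v :=
    DifferentiableAt.comp (g := fun p : ℝ × ℝ => β p.1 p.2) (f := fun t : ℝ => (u, t)) v hβ
      (by fun_prop)
  have hf0 : fderiv ℝ f ((u : Quaternion ℝ) + v • e1) 1 =
      deriv (fun t => α t v) u + e1 * deriv (fun t => β t v) u := by
    have hγ : HasDerivAt (fun t : ℝ => (t : Quaternion ℝ) + v • e1) 1 u :=
      (hasDerivAt_quaternion_coe u).add_const _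
    refine (hd.hasFDerivAt.comp_hasDerivAt u hγ).unique
      ((hαu.hasDerivAt.add (hβu.hasDerivAt.const_mul e1)).congr_of_eventuallyEq ?_)
    filter_upwards [hγ.continuousAt.preimage_mem_nhds (hopen.mem_nhds hq)] with t ht
    exact hf.2.2 t v e1 rfl norm_quaternion_e1 ht
  have hf1 : fderiv ℝ f ((u : Quaternion ℝ) + v • e1) e1 =
      deriv (fun t => α u t) v + e1 * deriv (fun t => β u t) v := by
    have hγ : HasDerivAt (fun t : ℝ => (u : Quaternion ℝ) + t • e1) e1 v := by
      simpa using ((hasDerivAt_id v).smul_const e1).const_add (u : Quaternion ℝ)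
    refine (hd.hasFDerivAt.comp_hasDerivAt v hγ).unique
      ((hαv.hasDerivAt.add (hβv.hasDerivAt.const_mul e1)).congr_of_eventuallyEq ?_)
    filter_upwards [hγ.continuousAt.preimage_mem_nhds (hopen.mem_nhds hq)] with t ht
    exact hf.2.2 u t e1 rfl norm_quaternion_e1 ht
  have he1 : e1 * e1 = -1 := by ext <;> simp
  have he2 : e2 * e2 = -1 := by ext <;> simp
  have he3 : e3 * e3 = -1 := by ext <;> simp
  have hslice : fderiv ℝ f ((u : Quaternion ℝ) + v • e1) 1 +
      e1 * fderiv ℝ f ((u : Quaternion ℝ) + v • e1) e1 = 0 := by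
    rw [hf0, hf1, mul_add, ← mul_assoc, he1]
    calc _ = (deriv (fun t => α t v) u - deriv (fun t => β u t) v) +
          e1 * (deriv (fun t => α u t) v + deriv (fun t => β t v) u) := by noncomm_ring
      _ = 0 := by rw [hcr1, hcr2, mul_zero, add_zero]
  rw [fueterL, hslice, zero_add, smul_add, ← mul_smul_comm, ← mul_smul_comm, hf2, hf3,
    ← mul_assoc, ← mul_assoc, he2, he3, neg_one_mul]
  module

/-- A slice hyperholomorphic function in the kernel of the Fueter operator has vanishing odd
component. -/
theorem IsSliceHypL.odd_part_eq_zero {U : Set (Quaternion ℝ)} {f : Quaternion ℝ → Quaternion ℝ}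
    {α β : ℝ → ℝ → Quaternion ℝ} (hf : IsSliceHypL U f α β) (hopen : IsOpen U)
    (hax : IsAxiallySymmetric U) (hker : ∀ q ∈ U, fueterL f q = 0) {u v : ℝ}
    (hs : inSlice U u v) : β u v = 0 := by
  by_cases hv : v = 0
  · subst hv
    have h := (hf.1 u 0 hs).2
    rw [neg_zero] at h
    have h2 : (2 : ℝ) • β u 0 = 0 := by rw [two_smul, ← eq_neg_iff_add_eq_zero, ← h]
    exact (smul_eq_zero.mp h2).resolve_left two_ne_zero
  · have h := hf.smul_fueterL hopen hax hs hv
    rw [hker _ (hs e1 rfl norm_quaternion_e1), smul_zero] at h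
    exact (smul_eq_zero.mp h.symm).resolve_left (by norm_num)

/-- A slice hyperholomorphic function in the kernel of the Fueter operator has an even component
with vanishing derivative. -/
theorem IsSliceHypL.hasFDerivAt_even_part_zero {U : Set (Quaternion ℝ)}
    {f : Quaternion ℝ → Quaternion ℝ}
    {α β : ℝ → ℝ → Quaternion ℝ} (hf : IsSliceHypL U f α β) (hopen : IsOpen U)
    (hax : IsAxiallySymmetric U) (hker : ∀ q ∈ U, fueterL f q = 0) {u v : ℝ}
    (hs : inSlice U u v) :
    HasFDerivAt (fun p : ℝ × ℝ => α p.1 p.2) (0 : ℝ × ℝ →L[ℝ] Quaternion ℝ) (u, v) := by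
  obtain ⟨hα, -, hcr1, hcr2⟩ := hf.2.1 u v hs
  have hnear : ∀ᶠ p : ℝ × ℝ in nhds (u, v), β p.1 p.2 = 0 := by
    filter_upwards [(hax.isOpen_inSlice hopen).mem_nhds hs] with p hp
    exact hf.odd_part_eq_zero hopen hax hker hp
  have hγu : HasDerivAt (fun t : ℝ => (t, v)) ((1 : ℝ), (0 : ℝ)) u :=
    (hasDerivAt_id u).prodMk (hasDerivAt_const u v)
  have hγv : HasDerivAt (fun t : ℝ => (u, t)) ((0 : ℝ), (1 : ℝ)) v :=
    (hasDerivAt_const v u).prodMk (hasDerivAt_id v)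
  have hβu : deriv (fun t => β t v) u = 0 := by
    have h : (fun t => β t v) =ᶠ[nhds u] fun _ => 0 := hγu.continuousAt.eventually hnear
    rw [h.deriv_eq, deriv_const]
  have hβv : deriv (fun t => β u t) v = 0 := by
    have h : (fun t => β u t) =ᶠ[nhds v] fun _ => 0 := hγv.continuousAt.eventually hnear
    rw [h.deriv_eq, deriv_const]
  rw [hβv, sub_zero] at hcr1
  rw [hβu, add_zero] at hcr2
  have h1 := (HasFDerivAt.comp_hasDerivAt u hα.hasFDerivAt hγu).deriv
  have h2 := (HasFDerivAt.comp_hasDerivAt v hα.hasFDerivAt hγv).deriv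
  have h1' := h1.symm.trans hcr1
  have h2' := h2.symm.trans hcr2
  have h : fderiv ℝ (fun p : ℝ × ℝ => α p.1 p.2) (u, v) = 0 := by
    ext1
    · ext1; exact h1'
    · ext1; exact h2'
  exact h ▸ hα.hasFDerivAt

/-- A left slice hyperholomorphic function in the kernel of the Fueter operator on a nonempty
connected axially symmetric open set intersecting the real line is constant. -/
theorem sliceHyp_fueter_ker_const
    (U : Set (Quaternion ℝ)) (hopen : IsOpen U) (hconn : IsConnected U)
    (hax : ∀ (u v : ℝ) (J : Quaternion ℝ), J.re = 0 → ‖J‖ = 1 →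
      (u : Quaternion ℝ) + v • J ∈ U →
      ∀ J' : Quaternion ℝ, J'.re = 0 → ‖J'‖ = 1 → (u : Quaternion ℝ) + v • J' ∈ U)
    (hreal : ∃ x : ℝ, (x : Quaternion ℝ) ∈ U)
    (f : Quaternion ℝ → Quaternion ℝ) (α β : ℝ → ℝ → Quaternion ℝ)
    (hf : IsSliceHypL U f α β)
    (hker : ∀ q ∈ U, fueterL f q = 0) :
    ∃ c : Quaternion ℝ, ∀ q ∈ U, f q = c := by
  have hax' : IsAxiallySymmetric U := hax
  have hfα {q : Quaternion ℝ} (hq : q ∈ U) : f q = α q.re ‖q.im‖ := by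
    obtain ⟨J, hJ, hJ', h⟩ := exists_imaginary_unit q
    have key := hf.2.2 q.re ‖q.im‖ J hJ hJ' (h ▸ hq)
    rwa [← h, hf.odd_part_eq_zero hopen hax' hker (hax'.inSlice_re_norm_im hq), mul_zero,
      add_zero] at key
  have hloc : ∀ q ∈ U, ∀ᶠ x in nhds q, f x = f q := by
    intro q hq
    have hs := hax'.inSlice_re_norm_im hq
    obtain ⟨r, hr, hball⟩ := Metric.isOpen_iff.mp (hax'.isOpen_inSlice hopen) (q.re, ‖q.im‖) hs
    filter_upwards [hopen.mem_nhds hq,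
      continuous_re_norm_im.continuousAt.preimage_mem_nhds (Metric.ball_mem_nhds _ hr)] with x hx hxr
    rw [hfα hx, hfα hq]
    exact (convex_ball (q.re, ‖q.im‖) r).is_const_of_fderivWithin_eq_zero (𝕜 := ℝ)
      (f := fun p : ℝ × ℝ => α p.1 p.2)
      (fun p hp => (hf.hasFDerivAt_even_part_zero hopen hax' hker
        (hball hp)).differentiableAt.differentiableWithinAt)
      (fun p hp => (hf.hasFDerivAt_even_part_zero hopen hax' hker
        (hball hp)).hasFDerivWithinAt.fderivWithin (Metric.isOpen_ball.uniqueDiffWithinAt hp))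
      hxr (Metric.mem_ball_self hr)
  obtain ⟨x, hx⟩ := hreal
  refine ⟨f x, fun q hq => ?_⟩
  refine hconn.isPreconnected.induction₂ (fun a b => f a = f b) ?_ (fun _ _ _ _ _ _ => Eq.trans)
    (fun _ _ _ _ => Eq.symm) hq hx
  intro a ha
  exact (hloc a ha).filter_mono nhdsWithin_le_nhds |>.mono fun _ h => h.symm
end
end

section
/- Let (aₘ)_{m≥0} ⊂ ℍ and ρ > 0 be such that ∑_{m=0}^{∞} ‖aₘ‖tᵐ < ∞ for every 0 ≤ t < ρ, and let f(x) := ∑_{m=0}^{∞} xᵐaₘ for |x| < ρ. Then for every q ∈ ℍ with |q| < ρ the Fueter derivative of f is given by the absolutely convergent series D f(q) = −2·∑_{m=1}^{∞} (∑_{k=1}^{m} q^{m−k}·q̄^{k−1})·aₘ. -/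
noncomputable section

open Quaternion Finset

theorem nat_mul_pow_mul_sub_le {s t : ℝ} (ht : 0 ≤ t) (hts : t ≤ s) (n : ℕ) :
    n * t ^ (n - 1) * (s - t) ≤ s ^ n := by
  have hgeom : n * t ^ (n - 1) ≤ ∑ i ∈ Finset.range n, s ^ i * t ^ (n - 1 - i) := by
    calc n * t ^ (n - 1) = ∑ _i ∈ Finset.range n, t ^ (n - 1) := by simp
      _ ≤ _ := by
        refine Finset.sum_le_sum fun i hi => ?_
        have hi' : i + (n - 1 - i) = n - 1 := by
          have := Finset.mem_range.1 hi
          omega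
        calc t ^ (n - 1) = t ^ i * t ^ (n - 1 - i) := by rw [← pow_add, hi']
          _ ≤ _ := by gcongr
  calc n * t ^ (n - 1) * (s - t)
      ≤ (∑ i ∈ Finset.range n, s ^ i * t ^ (n - 1 - i)) * (s - t) :=
        mul_le_mul_of_nonneg_right hgeom (sub_nonneg.2 hts)
    _ = s ^ n - t ^ n := (Commute.all s t).geom_sum₂_mul n
    _ ≤ s ^ n := sub_le_self _ (by positivity)

theorem summable_mul_nat_mul_pow {u : ℕ → ℝ} (hu : ∀ n, 0 ≤ u n) {s t : ℝ} (ht : 0 ≤ t)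
    (hts : t < s) (hs : Summable fun n => u n * s ^ n) :
    Summable fun n : ℕ => u n * (n * t ^ (n - 1)) := by
  have hst : 0 < s - t := sub_pos.2 hts
  refine Summable.of_nonneg_of_le (fun n => mul_nonneg (hu n) (by positivity)) (fun n => ?_)
    (hs.mul_right (s - t)⁻¹)
  rw [mul_assoc]
  refine mul_le_mul_of_nonneg_left ?_ (hu n)
  rw [le_mul_inv_iff₀ hst]
  exact nat_mul_pow_mul_sub_le ht hts.le n

section PowerSeries

variable {𝔸 : Type*} [NormedDivisionRing 𝔸] [NormedAlgebra ℝ 𝔸]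

open scoped RightActions in
/-- The real derivative of `x ↦ xⁿ c` on a real normed division algebra. -/
def powMulFDeriv (c : 𝔸) (n : ℕ) (x : 𝔸) : 𝔸 →L[ℝ] 𝔸 :=
  (∑ i ∈ Finset.range n, x ^ (n.pred - i) •> ContinuousLinearMap.id ℝ _ <• x ^ i) <• c

theorem powMulFDeriv_apply (c : 𝔸) (n : ℕ) (x v : 𝔸) :
    powMulFDeriv c n x v = (∑ i ∈ Finset.range n, x ^ (n - 1 - i) * v * x ^ i) * c := by
  simp [powMulFDeriv, mul_assoc]

theorem hasFDerivAt_pow_mul (c : 𝔸) (n : ℕ) (x : 𝔸) :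
    HasFDerivAt (fun y : 𝔸 => y ^ n * c) (powMulFDeriv c n x) x :=
  (hasFDerivAt_pow' n).mul_const' c

theorem norm_powMulFDeriv_le (c : 𝔸) (n : ℕ) {x : 𝔸} {t : ℝ}
    (hx : ‖x‖ ≤ t) : ‖powMulFDeriv c n x‖ ≤ ‖c‖ * (n * t ^ (n - 1)) := by
  have ht : 0 ≤ t := (norm_nonneg x).trans hx
  refine ContinuousLinearMap.opNorm_le_bound _ (by positivity) fun v => ?_
  have hsum : ‖∑ i ∈ Finset.range n, x ^ (n - 1 - i) * v * x ^ i‖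
      ≤ ∑ _i ∈ Finset.range n, t ^ (n - 1) * ‖v‖ := by
    refine norm_sum_le_of_le _ fun i hi => ?_
    have hi' : n - 1 - i + i = n - 1 := by
      have := Finset.mem_range.1 hi
      omega
    calc ‖x ^ (n - 1 - i) * v * x ^ i‖ = ‖x‖ ^ (n - 1) * ‖v‖ := by
          rw [← hi', norm_mul, norm_mul, norm_pow, norm_pow, pow_add, hi']
          ring
      _ ≤ t ^ (n - 1) * ‖v‖ := by gcongr
  rw [powMulFDeriv_apply, norm_mul]
  calc _ ≤ (∑ _i ∈ Finset.range n, t ^ (n - 1) * ‖v‖) * ‖c‖ := by gcongr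
    _ = _ := by
      simp only [Finset.sum_const, Finset.card_range, nsmul_eq_mul]
      ring

theorem hasFDerivAt_tsum_pow_mul [CompleteSpace 𝔸] {a : ℕ → 𝔸} {ρ : ℝ}
    (ha : ∀ t : ℝ, 0 ≤ t → t < ρ → Summable fun m : ℕ => ‖a m‖ * t ^ m)
    {q : 𝔸} (hq : ‖q‖ < ρ) :
    Summable (fun m => powMulFDeriv (a m) m q) ∧
    HasFDerivAt (fun x => ∑' m : ℕ, x ^ m * a m) (∑' m, powMulFDeriv (a m) m q) q := by
  obtain ⟨t, hqt, htρ⟩ := exists_between hq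
  obtain ⟨s, hts, hsρ⟩ := exists_between htρ
  have ht : 0 ≤ t := (norm_nonneg q).trans hqt.le
  have hu := summable_mul_nat_mul_pow (fun n => norm_nonneg (a n)) ht hts
    (ha s (ht.trans hts.le) hsρ)
  have hqball : q ∈ Metric.ball (0 : 𝔸) t := mem_ball_zero_iff.2 hqt
  refine ⟨hu.of_norm_bounded fun m => norm_powMulFDeriv_le _ _ hqt.le, ?_⟩
  refine hasFDerivAt_tsum_of_isPreconnected hu Metric.isOpen_ball
    (convex_ball (0 : 𝔸) t).isPreconnected
    (fun m x _ => hasFDerivAt_pow_mul (a m) m x)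
    (fun m x hx => norm_powMulFDeriv_le _ _ (mem_ball_zero_iff.1 hx).le) hqball ?_ hqball
  refine (ha ‖q‖ (norm_nonneg q) hq).of_norm_bounded fun m => ?_
  rw [norm_mul, norm_pow, mul_comm]

theorem hasSum_fderiv_apply_of_eq_tsum_pow_mul [CompleteSpace 𝔸] {a : ℕ → 𝔸} {ρ : ℝ}
    (ha : ∀ t : ℝ, 0 ≤ t → t < ρ → Summable fun m : ℕ => ‖a m‖ * t ^ m)
    {f : 𝔸 → 𝔸} (hf : ∀ x : 𝔸, ‖x‖ < ρ → f x = ∑' m : ℕ, x ^ m * a m)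
    {q : 𝔸} (hq : ‖q‖ < ρ) (v : 𝔸) :
    HasSum (fun m : ℕ => (∑ i ∈ Finset.range m, q ^ (m - 1 - i) * v * q ^ i) * a m)
      (fderiv ℝ f q v) := by
  obtain ⟨hsummable, hderiv⟩ := hasFDerivAt_tsum_pow_mul ha hq
  have hfe : f =ᶠ[nhds q] fun x => ∑' m : ℕ, x ^ m * a m := by
    filter_upwards [(isOpen_lt continuous_norm continuous_const).mem_nhds hq] with x hx
    exact hf x hx
  rw [(hderiv.congr_of_eventuallyEq hfe).fderiv]
  have happly := (ContinuousLinearMap.apply ℝ 𝔸 v).hasSum hsummable.hasSum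
  simpa only [ContinuousLinearMap.apply_apply, powMulFDeriv_apply] using happly

end PowerSeries

theorem add_sum_unit_mul_mul_unit (p : Quaternion ℝ) :
    p + e1 * (p * e1) + e2 * (p * e2) + e3 * (p * e3) = -2 * star p := by
  have htwo : (-2 : Quaternion ℝ) = ((-2 : ℝ) : Quaternion ℝ) := by norm_cast
  rw [htwo, Quaternion.coe_mul_eq_smul]
  have h1 : e1.re = 0 ∧ e1.imI = 1 ∧ e1.imJ = 0 ∧ e1.imK = 0 := ⟨rfl, rfl, rfl, rfl⟩
  have h2 : e2.re = 0 ∧ e2.imI = 0 ∧ e2.imJ = 1 ∧ e2.imK = 0 := ⟨rfl, rfl, rfl, rfl⟩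
  have h3 : e3.re = 0 ∧ e3.imI = 0 ∧ e3.imJ = 0 ∧ e3.imK = 1 := ⟨rfl, rfl, rfl, rfl⟩
  ext <;> simp [h1, h2, h3] <;> ring

theorem add_sum_unit_mul_sum_pow_mul_unit_mul_pow (c : Quaternion ℝ) (n : ℕ)
    (x : Quaternion ℝ) :
    (∑ i ∈ Finset.range n, x ^ (n - 1 - i) * 1 * x ^ i) * c
        + e1 * ((∑ i ∈ Finset.range n, x ^ (n - 1 - i) * e1 * x ^ i) * c)
        + e2 * ((∑ i ∈ Finset.range n, x ^ (n - 1 - i) * e2 * x ^ i) * c)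
        + e3 * ((∑ i ∈ Finset.range n, x ^ (n - 1 - i) * e3 * x ^ i) * c)
      = -2 * ((∑ k ∈ Finset.range n, x ^ (n - 1 - k) * star x ^ k) * c) := by
  have hx : Commute x (star x) := (star_comm_self' x).symm
  have hreflect : ∑ k ∈ Finset.range n, x ^ (n - 1 - k) * star x ^ k
      = ∑ i ∈ Finset.range n, star x ^ (n - 1 - i) * x ^ i := by
    rw [← Finset.sum_range_reflect]
    refine Finset.sum_congr rfl fun i hi => ?_
    have hi' : n - 1 - (n - 1 - i) = i := by
      have := Finset.mem_range.1 hi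
      omega
    rw [hi', (hx.pow_pow i (n - 1 - i)).eq]
  rw [hreflect]
  simp only [← mul_assoc, Finset.mul_sum, ← add_mul, ← Finset.sum_add_distrib]
  congr 1
  refine Finset.sum_congr rfl fun i _ => ?_
  rw [← star_pow, ← add_sum_unit_mul_mul_unit]
  simp only [mul_assoc, mul_one]

theorem norm_sum_pow_mul_star_pow_mul_le (c x : Quaternion ℝ) (n : ℕ) :
    ‖(∑ k ∈ Finset.range n, x ^ (n - 1 - k) * star x ^ k) * c‖
      ≤ ‖c‖ * (n * ‖x‖ ^ (n - 1)) := by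
  have hsum : ‖∑ k ∈ Finset.range n, x ^ (n - 1 - k) * star x ^ k‖
      ≤ ∑ _k ∈ Finset.range n, ‖x‖ ^ (n - 1) := by
    refine norm_sum_le_of_le _ fun k hk => le_of_eq ?_
    have hk' : n - 1 - k + k = n - 1 := by
      have := Finset.mem_range.1 hk
      omega
    rw [norm_mul, norm_pow, norm_pow, norm_star, ← pow_add, hk']
  rw [norm_mul, mul_comm]
  gcongr
  simpa using hsum

/-- Term-by-term Fueter differentiation of a power series: if `f(x) = ∑_m xᵐ aₘ` converges for
`|x| < ρ`, then for `|q| < ρ`,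
`D f(q) = −2 ∑_{m=1}^∞ (∑_{k=1}^m q^{m−k} q̄^{k−1}) aₘ`, the series converging absolutely.
(Reindexed: the term of index `m ∈ ℕ` is the paper's term of index `m + 1`.) -/
theorem fueter_power_series
    (a : ℕ → Quaternion ℝ) (ρ : ℝ)
    (hρ : 0 < ρ)
    (ha : ∀ t : ℝ, 0 ≤ t → t < ρ → Summable (fun m : ℕ => ‖a m‖ * t ^ m))
    (f : Quaternion ℝ → Quaternion ℝ)
    (hf : ∀ x : Quaternion ℝ, ‖x‖ < ρ → f x = ∑' m : ℕ, x ^ m * a m)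
    (q : Quaternion ℝ) (hq : ‖q‖ < ρ) :
    Summable (fun m : ℕ =>
      ‖(∑ k ∈ Finset.range (m + 1), q ^ (m - k) * (star q) ^ k) * a (m + 1)‖) ∧
    fueterL f q
      = -2 * ∑' m : ℕ, (∑ k ∈ Finset.range (m + 1), q ^ (m - k) * (star q) ^ k) * a (m + 1) := by
  obtain ⟨s, hqs, hsρ⟩ := exists_between hq
  have hsum : Summable fun m : ℕ =>
      ‖(∑ k ∈ Finset.range m, q ^ (m - 1 - k) * star q ^ k) * a m‖ :=
    (summable_mul_nat_mul_pow (fun n => norm_nonneg (a n)) (norm_nonneg q) hqs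
      (ha s ((norm_nonneg q).trans hqs.le) hsρ)).of_nonneg_of_le (fun _ => norm_nonneg _)
      fun m => norm_sum_pow_mul_star_pow_mul_le (a m) q m
  refine ⟨by simpa using (summable_nat_add_iff 1).2 hsum, ?_⟩
  have happly := hasSum_fderiv_apply_of_eq_tsum_pow_mul ha hf hq
  have hfueter := (((happly 1).add ((happly e1).mul_left e1)).add
    ((happly e2).mul_left e2)).add ((happly e3).mul_left e3)
  simp only [add_sum_unit_mul_sum_pow_mul_unit_mul_pow] at hfueter
  rw [fueterL, ← hfueter.tsum_eq, tsum_mul_left, hsum.of_norm.tsum_eq_zero_add]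
  simp
end
end
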